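/- Let q be an odd prime power with q ≡ 3 (mod 4) and q > 3, and set d = (q-3)/2. Let λ = ∑_{x∈F_q} χ(x(x²+4x-1)) + ∑_{x∈F_q} χ(x(x²-2x+5)), where χ is the quadratic character of F_q. Then the number of triples (y₁,y₂,y₃) ∈ (F_q*)³ with y₁ - y₂ + y₃ - 1 = 0 and y₁^d - y₂^d + y₃^d - 1 = 0 equals (5q + λ - 13)/2. -/

import Mathlib

open Finset

section QuadraticCharSums

variable {F : Type*} [Field F] [Fintype F]

theorem ringChar_ne_two_of_card_mod_four (h4 : Fintype.card F % 4 = 3) : ringChar F ≠ 2 := by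
  intro h
  have := FiniteField.even_card_of_char_two h
  omega

theorem sum_eq_zero_of_odd (f : F → ℤ) (h : ∀ x, f (-x) = -f x) : ∑ x : F, f x = 0 := by
  have h1 : ∑ x : F, f (-x) = ∑ x : F, f x := Equiv.sum_comp (Equiv.neg F) f
  simp only [h, Finset.sum_neg_distrib] at h1
  linarith

variable [DecidableEq F]

theorem quadraticChar_neg_of_card_mod_four (h4 : Fintype.card F % 4 = 3) (a : F) :
    quadraticChar F (-a) = -quadraticChar F a := by
  have h1 : quadraticChar F (-1) = -1 := by
    rw [quadraticChar_neg_one_iff_not_isSquare, FiniteField.isSquare_neg_one_iff]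
    simp [h4]
  rw [← neg_one_mul, map_mul, h1, neg_one_mul]

theorem sq_add_sq_ne_zero (h4 : Fintype.card F % 4 = 3) {a b : F} (hb : b ≠ 0) :
    a ^ 2 + b ^ 2 ≠ 0 := by
  intro h
  have h1 : quadraticChar F (-b ^ 2) = -1 := by
    rw [quadraticChar_neg_of_card_mod_four h4, quadraticChar_sq_one' hb]
  rw [← eq_neg_of_add_eq_zero_left h] at h1
  rw [quadraticChar_neg_one_iff_not_isSquare] at h1
  exact h1 ⟨a, sq a⟩

/-- Two nonzero elements whose product is a square have the same quadratic character. -/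
theorem quadraticChar_eq_of_mul_eq_sq {a b s : F} (ha : a ≠ 0) (hb : b ≠ 0) (h : a * b = s ^ 2) :
    quadraticChar F a = quadraticChar F b := by
  have hs : s ≠ 0 := by
    rintro rfl
    simp [ha, hb] at h
  have h1 : quadraticChar F a * quadraticChar F b = 1 := by
    rw [← map_mul, h, quadraticChar_sq_one' hs]
  rcases quadraticChar_dichotomy ha with h2 | h2 <;> rw [h2] at h1 ⊢ <;> linarith

theorem quadraticChar_inv (a : F) : quadraticChar F a⁻¹ = quadraticChar F a := by
  by_cases ha : a = 0
  · simp [ha]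
  · exact quadraticChar_eq_of_mul_eq_sq (s := 1) (inv_ne_zero ha) ha (by simp [ha])

theorem quadraticChar_div (a b : F) :
    quadraticChar F (a / b) = quadraticChar F a * quadraticChar F b := by
  rw [div_eq_mul_inv, map_mul, quadraticChar_inv]

theorem ne_zero_of_quadraticChar_eq_one {a : F} (h : quadraticChar F a = 1) : a ≠ 0 := by
  rintro rfl
  simp at h

theorem card_filter_sq_eq (hF : ringChar F ≠ 2) (a : F) :
    (#{x : F | x ^ 2 = a} : ℤ) = quadraticChar F a + 1 := by
  rw [← quadraticChar_card_sqrts hF a]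
  congr 2
  ext x
  simp

theorem sum_comp_sq (hF : ringChar F ≠ 2) (f : F → ℤ) :
    ∑ x : F, f (x ^ 2) = ∑ s : F, f s + ∑ s : F, quadraticChar F s * f s := by
  rw [← Finset.sum_fiberwise (s := univ) (g := fun x : F ↦ x ^ 2), ← Finset.sum_add_distrib]
  refine Finset.sum_congr rfl fun s _ ↦ ?_
  rw [Finset.sum_congr rfl (g := fun _ ↦ f s) (by simp +contextual), Finset.sum_const,
    nsmul_eq_mul, card_filter_sq_eq hF]
  ring

theorem sum_quadraticChar_mul_sub (hF : ringChar F ≠ 2) {c : F} (hc : c ≠ 0) :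
    ∑ s : F, quadraticChar F (s * (s - c)) = -1 := by
  have h1 : ∑ s : F, quadraticChar F (s * (s - c)) =
      ∑ s ∈ univ.erase (0 : F), quadraticChar F (s * (s - c)) := by
    rw [Finset.sum_erase]; simp
  have h2 : ∑ s ∈ univ.erase (0 : F), quadraticChar F (s * (s - c)) =
      ∑ v ∈ univ.erase (1 : F), quadraticChar F v := by
    refine Finset.sum_bij' (fun s _ ↦ 1 - c / s) (fun v _ ↦ c / (1 - v)) ?_ ?_ ?_ ?_ ?_
    · intro s hs
      simp at hs ⊢
      exact ⟨hc, hs⟩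
    · intro v hv
      simp at hv ⊢
      exact ⟨hc, fun h ↦ hv (by linear_combination -h)⟩
    · intro s hs
      simp at hs
      field_simp
      simp [hc]
    · intro v hv
      simp at hv
      have : 1 - v ≠ 0 := fun h ↦ hv (by linear_combination -h)
      field_simp
      ring
    · intro s hs
      simp at hs
      have : s * (s - c) = s ^ 2 * (1 - c / s) := by field_simp
      rw [this, map_mul, quadraticChar_sq_one' hs, one_mul]
  rw [h1, h2]
  have := Finset.sum_erase_add univ (quadraticChar F) (mem_univ 1)
  rw [quadraticChar_sum_zero hF, map_one] at this
  linarith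

theorem sum_quadraticChar_sq_sub (hF : ringChar F ≠ 2) {c : F} (hc : c ≠ 0) :
    ∑ s : F, quadraticChar F (s ^ 2 - c) = -1 := by
  rw [sum_comp_sq hF fun s ↦ quadraticChar F (s - c)]
  simp only [← map_mul]
  rw [sum_quadraticChar_mul_sub hF hc]
  have : ∑ s : F, quadraticChar F (s - c) = ∑ s : F, quadraticChar F s :=
    Equiv.sum_comp (Equiv.subRight c) _
  rw [this, quadraticChar_sum_zero hF, zero_add]

/-- The character sums attached to two 2-isogenous elliptic curves agree. -/
theorem sum_quadraticChar_isogeny (hF : ringChar F ≠ 2) (a : F) {b : F} (hb : b ≠ 0) :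
    ∑ x : F, quadraticChar F (x * (x ^ 2 + a * x + b)) =
      ∑ v : F, quadraticChar F (v * (v ^ 2 - 2 * a * v + (a ^ 2 - 4 * b))) := by
  have h2 : (2 : F) ≠ 0 := Ring.two_ne_zero hF
  have h1 : ∑ x : F, quadraticChar F (x * (x ^ 2 + a * x + b)) =
      ∑ x ∈ univ.erase (0 : F), quadraticChar F (x + b / x + a) := by
    rw [← Finset.sum_erase (a := (0 : F)) univ (by simp)]
    refine Finset.sum_congr rfl fun x hx ↦ ?_
    simp at hx
    have : x * (x ^ 2 + a * x + b) = x ^ 2 * (x + b / x + a) := by field_simp; ring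
    rw [this, map_mul, quadraticChar_sq_one' hx, one_mul]
  have hcard (u : F) : (#{x ∈ univ.erase (0 : F) | x + b / x = u} : ℤ) =
      quadraticChar F (u ^ 2 - 4 * b) + 1 := by
    rw [← card_filter_sq_eq hF]
    congr 1
    refine Finset.card_bij' (fun x _ ↦ 2 * x - u) (fun y _ ↦ (y + u) / 2) ?_ ?_ ?_ ?_
    · intro x hx
      simp at hx ⊢
      obtain ⟨hx, rfl⟩ := hx
      field_simp
      ring
    · intro y hy
      simp at hy ⊢
      have h0 : y + u ≠ 0 := by
        intro h
        have : (2 * 2) * b = 0 := by linear_combination hy - (y - u) * h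
        simp [h2, hb] at this
      refine ⟨⟨h0, h2⟩, ?_⟩
      field_simp
      linear_combination hy
    · intro x _
      field_simp
      ring
    · intro y _
      field_simp
      ring
  have h3 : ∑ x ∈ univ.erase (0 : F), quadraticChar F (x + b / x + a) =
      ∑ u : F, (quadraticChar F (u ^ 2 - 4 * b) + 1) * quadraticChar F (u + a) := by
    rw [← Finset.sum_fiberwise (g := fun x : F ↦ x + b / x)]
    refine Finset.sum_congr rfl fun u _ ↦ ?_
    rw [Finset.sum_congr rfl (g := fun _ ↦ quadraticChar F (u + a)) (by simp +contextual),
      Finset.sum_const, nsmul_eq_mul, hcard]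
  rw [h1, h3]
  rw [← Equiv.sum_comp (Equiv.subRight a)]
  simp only [add_mul, one_mul, Finset.sum_add_distrib, ← map_mul, Equiv.subRight_apply,
    sub_add_cancel, quadraticChar_sum_zero hF, add_zero]
  refine Finset.sum_congr rfl fun v _ ↦ ?_
  congr 1
  ring

end QuadraticCharSums

section SquareTriples

variable {F : Type*} [Field F] [Fintype F] [DecidableEq F]

/-- Triples of nonzero squares `a, b, c` with `a + b + 1 = c` and `1 / a + 1 / b = 1 / c + 1`. -/
def squareTriples (F : Type*) [Field F] [Fintype F] [DecidableEq F] : Finset (F × F × F) :=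
  {y | quadraticChar F y.1 = 1 ∧ quadraticChar F y.2.1 = 1 ∧ quadraticChar F y.2.2 = 1 ∧
    y.1 + y.2.1 + 1 = y.2.2 ∧ y.2.2 * (y.1 + y.2.1) = y.1 * y.2.1 * (y.2.2 + 1)}

/-- The nonzero squares `R` with `R ^ 2 + X ^ 2 * R = 1`. -/
def squareRoots (X : F) : Finset F :=
  {R | quadraticChar F R = 1 ∧ R ^ 2 + X ^ 2 * R = 1}

theorem sub_ne_zero_of_mul_sub_one_eq {K : Type*} [Field K] (hK : ringChar K ≠ 2) {c t : K}
    (ht : t ≠ 0) (hk : c * (c - 1) = t ^ 2 * (c + 1)) : c - t ^ 2 ≠ 0 := by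
  intro h
  have h3 : (2 : K) * t ^ 2 = 0 := by linear_combination (c - 1) * h - hk
  simp [Ring.two_ne_zero hK, ht] at h3

theorem four_mul_card_squareTriples (h4 : Fintype.card F % 4 = 3) :
    4 * (#(squareTriples F) : ℤ) =
      ∑ X ∈ univ.erase (0 : F), ∑ R ∈ squareRoots X,
        (#{p : F | p ^ 2 = 2 * R * (1 + X) / (1 - R)} : ℤ) *
          #{m : F | m ^ 2 = 2 * R * (1 - X) / (1 - R)} := by
  have hF := ringChar_ne_two_of_card_mod_four h4
  have h2 : (2 : F) ≠ 0 := Ring.two_ne_zero hF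
  have hleft : 4 * (#(squareTriples F) : ℤ) = #((squareTriples F).sigma fun y ↦
      ({u : F | u ^ 2 = y.1} : Finset F) ×ˢ ({v : F | v ^ 2 = y.2.1} : Finset F)) := by
    rw [card_sigma, Nat.cast_sum, Finset.sum_congr rfl (g := fun _ ↦ (4 : ℤ)), Finset.sum_const,
      nsmul_eq_mul, mul_comm]
    intro y hy
    simp only [squareTriples, mem_filter, mem_univ, true_and] at hy
    rw [card_product, Nat.cast_mul, card_filter_sq_eq hF, card_filter_sq_eq hF, hy.1, hy.2.1]
    norm_num
  have hright : ∑ X ∈ univ.erase (0 : F), ∑ R ∈ squareRoots X,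
        (#{p : F | p ^ 2 = 2 * R * (1 + X) / (1 - R)} : ℤ) *
          #{m : F | m ^ 2 = 2 * R * (1 - X) / (1 - R)} =
      #(((univ.erase (0 : F)).sigma fun X ↦ squareRoots X).sigma fun z ↦
        ({p : F | p ^ 2 = 2 * z.2 * (1 + z.1) / (1 - z.2)} : Finset F) ×ˢ
          ({m : F | m ^ 2 = 2 * z.2 * (1 - z.1) / (1 - z.2)} : Finset F)) := by
    rw [card_sigma, Finset.sum_sigma]
    simp
  rw [hleft, hright]
  congr 1
  refine Finset.card_bij'
    (fun z _ ↦ ⟨⟨(z.1.2.2 - (z.2.1 * z.2.2) ^ 2) / (z.2.1 * z.2.2),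
      (z.2.1 * z.2.2) ^ 2 / z.1.2.2⟩, (z.2.1 + z.2.2, z.2.1 - z.2.2)⟩)
    (fun z _ ↦ ⟨(((z.2.1 + z.2.2) / 2) ^ 2, ((z.2.1 - z.2.2) / 2) ^ 2,
      (1 + z.1.2) / (1 - z.1.2)), ((z.2.1 + z.2.2) / 2, (z.2.1 - z.2.2) / 2)⟩) ?_ ?_ ?_ ?_
  · rintro ⟨⟨a, b, c⟩, u, v⟩ h
    simp only [squareTriples, squareRoots, mem_sigma, mem_filter, mem_univ, true_and, mem_product,
      mem_erase, ne_eq, and_true] at h ⊢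
    obtain ⟨⟨ha, hb, hc, h1, h3⟩, rfl, rfl⟩ := h
    have hu : u ≠ 0 := by rintro rfl; simp at ha
    have hv : v ≠ 0 := by rintro rfl; simp at hb
    have hc0 := ne_zero_of_quadraticChar_eq_one hc
    have hk : c * (c - 1) = (u * v) ^ 2 * (c + 1) := by linear_combination h3 - c * h1
    have hct := sub_ne_zero_of_mul_sub_one_eq hF (mul_ne_zero hu hv) hk
    have hr : 1 - (u * v) ^ 2 / c ≠ 0 := by
      rw [one_sub_div hc0]
      exact div_ne_zero hct hc0
    refine ⟨⟨?_, ?_, ?_⟩, ?_, ?_⟩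
    · simp [hct, hu, hv]
    · rw [quadraticChar_div, hc, quadraticChar_sq_one' (mul_ne_zero hu hv), one_mul]
    · field_simp
      linear_combination (c - (u * v) ^ 2) * hk
    · rw [eq_div_iff hr]
      field_simp
      linear_combination (c - (u * v) ^ 2) * h1 + hk
    · rw [eq_div_iff hr]
      field_simp
      linear_combination (c - (u * v) ^ 2) * h1 + hk
  · rintro ⟨⟨X, R⟩, p, m⟩ h
    simp only [squareTriples, squareRoots, mem_sigma, mem_filter, mem_univ, true_and, mem_product,
      mem_erase, ne_eq, and_true] at h ⊢
    obtain ⟨⟨hX, hR, h1⟩, hp, hm⟩ := h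
    have hR0 := ne_zero_of_quadraticChar_eq_one hR
    have hXR : (1 - R) * (1 + R) = X ^ 2 * R := by linear_combination -h1
    have hne : (1 - R) * (1 + R) ≠ 0 := by rw [hXR]; simp [hX, hR0]
    have hm1 : 1 - R ≠ 0 := left_ne_zero_of_mul hne
    rw [eq_div_iff hm1] at hp hm
    have huv : (p + m) / 2 * ((p - m) / 2) = R * X / (1 - R) := by
      field_simp
      linear_combination hp - hm
    have hS : ((p + m) / 2) ^ 2 + ((p - m) / 2) ^ 2 = 2 * R / (1 - R) := by
      field_simp
      linear_combination 2 * (hp + hm)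
    have hn : (p + m) / 2 * ((p - m) / 2) ≠ 0 := by
      rw [huv]
      exact div_ne_zero (mul_ne_zero hR0 hX) hm1
    refine ⟨quadraticChar_sq_one' (left_ne_zero_of_mul hn),
      quadraticChar_sq_one' (right_ne_zero_of_mul hn), ?_, ?_, ?_⟩
    · rw [quadraticChar_div, ← map_mul, mul_comm, hXR, map_mul, quadraticChar_sq_one' hX, hR,
        one_mul]
    · rw [hS]
      field_simp
      ring
    · rw [hS, ← mul_pow, huv]
      field_simp
      linear_combination 2 * hXR
  · rintro ⟨⟨a, b, c⟩, u, v⟩ h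
    simp only [squareTriples, mem_sigma, mem_filter, mem_univ, true_and, mem_product] at h
    obtain ⟨⟨ha, hb, hc, h1, h3⟩, rfl, rfl⟩ := h
    have hu : u ≠ 0 := by rintro rfl; simp at ha
    have hv : v ≠ 0 := by rintro rfl; simp at hb
    have hc0 := ne_zero_of_quadraticChar_eq_one hc
    have hk : c * (c - 1) = (u * v) ^ 2 * (c + 1) := by linear_combination h3 - c * h1
    have hct := sub_ne_zero_of_mul_sub_one_eq hF (mul_ne_zero hu hv) hk
    have hu' : (u + v + (u - v)) / 2 = u := by field_simp; ring
    have hv' : (u + v - (u - v)) / 2 = v := by field_simp; ring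
    have hc' : (1 + (u * v) ^ 2 / c) / (1 - (u * v) ^ 2 / c) = c := by
      rw [one_add_div hc0, one_sub_div hc0, div_div_div_cancel_right₀ hc0, div_eq_iff hct]
      linear_combination -hk
    simp only [hu', hv', hc']
  · rintro ⟨⟨X, R⟩, p, m⟩ h
    simp only [squareRoots, mem_sigma, mem_filter, mem_univ, true_and, mem_product,
      mem_erase, ne_eq, and_true] at h ⊢
    obtain ⟨⟨hX, hR, h1⟩, hp, hm⟩ := h
    have hR0 := ne_zero_of_quadraticChar_eq_one hR
    have hXR : (1 - R) * (1 + R) = X ^ 2 * R := by linear_combination -h1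
    have hne : (1 - R) * (1 + R) ≠ 0 := by rw [hXR]; simp [hX, hR0]
    have hm1 : 1 - R ≠ 0 := left_ne_zero_of_mul hne
    have hp1 : 1 + R ≠ 0 := right_ne_zero_of_mul hne
    rw [eq_div_iff hm1] at hp hm
    have huv : (p + m) / 2 * ((p - m) / 2) = R * X / (1 - R) := by
      field_simp
      linear_combination hp - hm
    have hp' : (p + m) / 2 + (p - m) / 2 = p := by field_simp; ring
    have hm' : (p + m) / 2 - (p - m) / 2 = m := by field_simp; ring
    have hX' : ((1 + R) / (1 - R) - (R * X / (1 - R)) ^ 2) / (R * X / (1 - R)) = X := by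
      field_simp
      linear_combination hXR
    have hR' : (R * X / (1 - R)) ^ 2 / ((1 + R) / (1 - R)) = R := by
      field_simp
      linear_combination -hXR
    simp only [huv, hp', hm', hX', hR']

/-- If `R ^ 2 + X ^ 2 * R = 1` has roots, exactly one of the two is a square. -/
theorem two_mul_card_squareRoots (h4 : Fintype.card F % 4 = 3) (X : F) :
    2 * (#(squareRoots X) : ℤ) = quadraticChar F (X ^ 4 + 4) + 1 := by
  have hF := ringChar_ne_two_of_card_mod_four h4
  have h2 : (2 : F) ≠ 0 := Ring.two_ne_zero hF
  have hall : #{R : F | R ^ 2 + X ^ 2 * R = 1} = #{D : F | D ^ 2 = X ^ 4 + 4} := by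
    refine Finset.card_bij' (fun R _ ↦ 2 * R + X ^ 2) (fun D _ ↦ (D - X ^ 2) / 2) ?_ ?_ ?_ ?_
    · intro R hR
      simp only [mem_filter, mem_univ, true_and] at hR ⊢
      linear_combination 4 * hR
    · intro D hD
      simp only [mem_filter, mem_univ, true_and] at hD ⊢
      field_simp
      linear_combination hD
    · intro R _
      field_simp
      ring
    · intro D _
      field_simp
      ring
  have hneg : #{R ∈ ({R : F | R ^ 2 + X ^ 2 * R = 1} : Finset F) | ¬ quadraticChar F R = 1} =
      #(squareRoots X) := by
    refine Finset.card_bij' (fun R _ ↦ -R⁻¹) (fun R _ ↦ -R⁻¹) ?_ ?_ ?_ ?_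
    · intro R hR
      simp only [squareRoots, mem_filter, mem_univ, true_and] at hR ⊢
      have hR0 : R ≠ 0 := by rintro rfl; simp at hR
      rw [← quadraticChar_eq_neg_one_iff_not_one hR0] at hR
      refine ⟨by rw [quadraticChar_neg_of_card_mod_four h4, quadraticChar_inv, hR.2, neg_neg], ?_⟩
      field_simp
      linear_combination -hR.1
    · intro R hR
      simp only [squareRoots, mem_filter, mem_univ, true_and] at hR ⊢
      have hR0 : R ≠ 0 := by rintro rfl; simp at hR
      refine ⟨?_, by
        rw [quadraticChar_neg_of_card_mod_four h4, quadraticChar_inv, hR.1]; norm_num⟩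
      field_simp
      linear_combination -hR.2
    · simp
    · simp
  have hpos : ({R ∈ ({R : F | R ^ 2 + X ^ 2 * R = 1} : Finset F) | quadraticChar F R = 1}) =
      squareRoots X := by
    ext R
    simp [squareRoots, and_comm]
  have := Finset.card_filter_add_card_filter_not (s := ({R : F | R ^ 2 + X ^ 2 * R = 1} : Finset F))
    (fun R ↦ quadraticChar F R = 1)
  rw [hneg, hpos, hall] at this
  rw [← card_filter_sq_eq hF, ← this]
  push_cast
  ring

theorem quadraticChar_of_mem_squareRoots (h4 : Fintype.card F % 4 = 3) {X R : F} (hX : X ≠ 0)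
    (hR : R ∈ squareRoots X) :
    quadraticChar F (2 * R * (1 + X) / (1 - R)) =
      quadraticChar F (2 * (1 + X) * (X ^ 2 - 2 * X + 2)) := by
  simp only [squareRoots, mem_filter, mem_univ, true_and] at hR
  obtain ⟨hR, h1⟩ := hR
  have hR0 := ne_zero_of_quadraticChar_eq_one hR
  have hXR : (1 - R) * (1 + R) = X ^ 2 * R := by linear_combination -h1
  have hne : (1 - R) * (1 + R) ≠ 0 := by rw [hXR]; simp [hX, hR0]
  have hm1 : 1 - R ≠ 0 := left_ne_zero_of_mul hne
  have hp1 : 1 + R ≠ 0 := right_ne_zero_of_mul hne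
  by_cases hX1 : 1 + X = 0
  · simp [hX1]
  have hq : X ^ 2 - 2 * X + 2 ≠ 0 := by
    have := sq_add_sq_ne_zero h4 (a := X - 1) (one_ne_zero (α := F))
    intro h
    exact this (by linear_combination h)
  have hquad : quadraticChar F (R * (1 - R)) = quadraticChar F (X ^ 2 - 2 * X + 2) := by
    rw [map_mul, hR, one_mul]
    have e1 : quadraticChar F (1 - R) = quadraticChar F (R * (R + 1)) := by
      refine quadraticChar_eq_of_mul_eq_sq (s := X * R) hm1 ?_ ?_
      · simpa [hR0, add_comm] using hp1
      · linear_combination R * hXR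
    rw [e1]
    refine quadraticChar_eq_of_mul_eq_sq (s := (R * (R + 1) + X) / (X + 1)) ?_ hq ?_
    · simpa [hR0, add_comm] using hp1
    · have : X + 1 ≠ 0 := by rwa [add_comm]
      field_simp
      linear_combination (-R ^ 2 + (X ^ 2 - 2) * R + X ^ 2) * h1
  rw [quadraticChar_div, ← map_mul, show 2 * R * (1 + X) * (1 - R) =
    2 * (1 + X) * (R * (1 - R)) by ring, map_mul, hquad, ← map_mul]

theorem eight_mul_card_squareTriples_eq_sum (h4 : Fintype.card F % 4 = 3) :
    8 * (#(squareTriples F) : ℤ) =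
      ∑ X : F, (quadraticChar F (X ^ 4 + 4) + 1) *
        ((quadraticChar F (2 * (1 + X) * (X ^ 2 - 2 * X + 2)) + 1) *
          (quadraticChar F (2 * (1 - X) * (X ^ 2 + 2 * X + 2)) + 1)) - 8 := by
  have hF := ringChar_ne_two_of_card_mod_four h4
  have h2 : (2 : F) ≠ 0 := Ring.two_ne_zero hF
  have hχ4 : quadraticChar F 4 = 1 := by
    rw [show (4 : F) = 2 ^ 2 by norm_num, quadraticChar_sq_one' h2]
  rw [← Finset.sum_erase_add _ _ (mem_univ (0 : F))]
  have h0 : (2 : F) * 2 = 4 := by norm_num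
  simp only [ne_eq, OfNat.ofNat_ne_zero, not_false_eq_true, zero_pow, zero_add, hχ4, add_zero,
    mul_one, mul_zero, sub_zero, h0]
  have h8 : 8 * (#(squareTriples F) : ℤ) = 2 * (4 * #(squareTriples F)) := by ring
  rw [h8, four_mul_card_squareTriples h4, Finset.mul_sum,
    show ((1 : ℤ) + 1) * ((1 + 1) * (1 + 1)) = 8 by norm_num, add_sub_cancel_right]
  refine Finset.sum_congr rfl fun X hX ↦ ?_
  have hX0 : X ≠ 0 := by simpa using hX
  rw [← two_mul_card_squareRoots h4, mul_assoc]
  congr 1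
  rw [← nsmul_eq_mul, ← Finset.sum_const]
  refine Finset.sum_congr rfl fun R hR ↦ ?_
  rw [card_filter_sq_eq hF, card_filter_sq_eq hF, quadraticChar_of_mem_squareRoots h4 hX0 hR]
  have hR' : R ∈ squareRoots (-X) := by simpa [squareRoots] using hR
  have := quadraticChar_of_mem_squareRoots h4 (neg_ne_zero.2 hX0) hR'
  simp only [← sub_eq_add_neg, neg_sq, mul_neg, sub_neg_eq_add] at this
  rw [this]

theorem sum_quadraticChar_quartic (h4 : Fintype.card F % 4 = 3) :
    ∑ X : F, quadraticChar F (X ^ 4 + 4) = -1 := by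
  have hF := ringChar_ne_two_of_card_mod_four h4
  have h2 : (2 : F) ≠ 0 := Ring.two_ne_zero hF
  have h := sum_comp_sq hF fun s : F ↦ quadraticChar F (s ^ 2 + 4)
  have hodd : ∑ s : F, quadraticChar F s * quadraticChar F (s ^ 2 + 4) = 0 :=
    sum_eq_zero_of_odd _ fun s ↦ by
      rw [neg_sq, quadraticChar_neg_of_card_mod_four h4, neg_mul]
  have hsq := sum_quadraticChar_sq_sub hF (c := -(2 ^ 2 : F)) (by simp [h2])
  rw [hodd, add_zero] at h
  rw [← hsq]
  convert h using 3 <;> ring_nf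

theorem sum_quadraticChar_sextic (h4 : Fintype.card F % 4 = 3) :
    ∑ X : F, quadraticChar F ((1 - X ^ 2) * (X ^ 4 + 4)) =
      ∑ y : F, quadraticChar F (y * (y ^ 2 - 2 * y + 5)) -
        ∑ z : F, quadraticChar F (2 * z * (z ^ 2 - 4 * z + 5)) + 1 := by
  have hF := ringChar_ne_two_of_card_mod_four h4
  have h2 : (2 : F) ≠ 0 := Ring.two_ne_zero hF
  have h := sum_comp_sq hF fun s : F ↦ quadraticChar F ((1 - s) * (s ^ 2 + 4))
  have hfirst : ∑ s : F, quadraticChar F ((1 - s) * (s ^ 2 + 4)) =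
      ∑ y : F, quadraticChar F (y * (y ^ 2 - 2 * y + 5)) := by
    rw [← Equiv.sum_comp (Equiv.subLeft (1 : F))]
    refine Finset.sum_congr rfl fun y _ ↦ ?_
    rw [Equiv.subLeft_apply]
    congr 1
    ring
  have hinv (x : F) : quadraticChar F x⁻¹ * quadraticChar F ((1 - x⁻¹) * ((x⁻¹) ^ 2 + 4)) =
      quadraticChar F ((x - 1) * (4 * x ^ 2 + 1)) + if x = 0 then 1 else 0 := by
    split_ifs with hx
    · simp [hx, quadraticChar_neg_of_card_mod_four h4]
    · have : (x - 1) * (4 * x ^ 2 + 1) = (x ^ 2) ^ 2 * (x⁻¹ * ((1 - x⁻¹) * ((x⁻¹) ^ 2 + 4))) := by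
        field_simp
        ring
      rw [← map_mul, this, map_mul _ ((x ^ 2) ^ 2), quadraticChar_sq_one' (pow_ne_zero 2 hx), one_mul,
        add_zero]
  have hsecond : ∑ s : F, quadraticChar F s * quadraticChar F ((1 - s) * (s ^ 2 + 4)) =
      -∑ z : F, quadraticChar F (2 * z * (z ^ 2 - 4 * z + 5)) + 1 := by
    rw [← Equiv.sum_comp (Equiv.inv F)]
    simp only [Equiv.inv_apply, hinv, Finset.sum_add_distrib, Finset.sum_ite_eq', mem_univ,
      if_true]
    rw [← Equiv.sum_comp ((Equiv.mulRight₀ (2⁻¹ : F) (inv_ne_zero h2)).trans (Equiv.subLeft 1)),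
      ← Finset.sum_neg_distrib]
    congr 1
    refine Finset.sum_congr rfl fun z _ ↦ ?_
    simp only [Equiv.trans_apply, Equiv.subLeft_apply, Equiv.mulRight₀_apply]
    have : (1 - z * 2⁻¹ - 1) * (4 * (1 - z * 2⁻¹) ^ 2 + 1) =
        -((2⁻¹) ^ 2 * (2 * z * (z ^ 2 - 4 * z + 5))) := by
      field_simp
      ring
    rw [this, quadraticChar_neg_of_card_mod_four h4, map_mul,
      quadraticChar_sq_one' (inv_ne_zero h2), one_mul]
  rw [hfirst, hsecond] at h
  rw [sub_add, sub_eq_add_neg, neg_sub', sub_neg_eq_add, ← h]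
  refine Finset.sum_congr rfl fun X _ ↦ ?_
  ring_nf

theorem eight_mul_card_squareTriples (h4 : Fintype.card F % 4 = 3) :
    8 * (#(squareTriples F) : ℤ) = Fintype.card F +
      ((∑ x : F, quadraticChar F (x * (x ^ 2 + 4 * x - 1))) +
        ∑ x : F, quadraticChar F (x * (x ^ 2 - 2 * x + 5))) - 7 := by
  have hF := ringChar_ne_two_of_card_mod_four h4
  have h2 : (2 : F) ≠ 0 := Ring.two_ne_zero hF
  have hpt (X : F) : (quadraticChar F (X ^ 4 + 4) + 1) *
        ((quadraticChar F (2 * (1 + X) * (X ^ 2 - 2 * X + 2)) + 1) *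
          (quadraticChar F (2 * (1 - X) * (X ^ 2 + 2 * X + 2)) + 1)) =
      1 + quadraticChar F (X ^ 4 + 4) + quadraticChar F (1 - X ^ 2) +
        quadraticChar F ((1 - X ^ 2) * (X ^ 4 + 4)) +
        quadraticChar F (2 * (1 + X) * (X ^ 2 - 2 * X + 2)) +
        quadraticChar F (2 * (1 - X) * (X ^ 2 + 2 * X + 2)) +
        quadraticChar F (2 * (1 + X) * (X ^ 2 + 2 * X + 2)) +
        quadraticChar F (2 * (1 - X) * (X ^ 2 - 2 * X + 2)) := by
    have hp : X ^ 2 + 2 * X + 2 ≠ 0 := fun h ↦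
      sq_add_sq_ne_zero h4 (a := X + 1) (one_ne_zero (α := F)) (by linear_combination h)
    have hm : X ^ 2 - 2 * X + 2 ≠ 0 := fun h ↦
      sq_add_sq_ne_zero h4 (a := X - 1) (one_ne_zero (α := F)) (by linear_combination h)
    have e2 := quadraticChar_sq_one h2
    have ep := quadraticChar_sq_one hp
    have em := quadraticChar_sq_one hm
    rw [show X ^ 4 + 4 = (X ^ 2 + 2 * X + 2) * (X ^ 2 - 2 * X + 2) by ring,
      show 1 - X ^ 2 = (1 + X) * (1 - X) by ring]
    simp only [map_mul]
    generalize quadraticChar F 2 = e at *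
    generalize quadraticChar F (1 + X) = a at *
    generalize quadraticChar F (1 - X) = b at *
    generalize quadraticChar F (X ^ 2 + 2 * X + 2) = s at *
    generalize quadraticChar F (X ^ 2 - 2 * X + 2) = t at *
    linear_combination (s * t + 1) * a * b * s * t * e2 + (a * b * t ^ 2 + e * b * t) * ep +
      (a * b + e * a * s) * em
  have hone : ∑ X : F, quadraticChar F (1 - X ^ 2) = 1 := by
    have h := sum_quadraticChar_sq_sub hF (one_ne_zero (α := F))
    have : ∀ X : F, quadraticChar F (1 - X ^ 2) = -quadraticChar F (X ^ 2 - 1) := fun X ↦ by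
      rw [← quadraticChar_neg_of_card_mod_four h4, neg_sub]
    simp only [this, Finset.sum_neg_distrib, h, neg_neg]
  have hh : ∑ X : F, quadraticChar F (2 * (1 + X) * (X ^ 2 - 2 * X + 2)) =
      ∑ z : F, quadraticChar F (2 * z * (z ^ 2 - 4 * z + 5)) := by
    rw [← Equiv.sum_comp (Equiv.subRight (1 : F))]
    refine Finset.sum_congr rfl fun z _ ↦ ?_
    rw [Equiv.subRight_apply]
    congr 1
    ring
  have hh' : ∑ X : F, quadraticChar F (2 * (1 - X) * (X ^ 2 + 2 * X + 2)) =
      ∑ z : F, quadraticChar F (2 * z * (z ^ 2 - 4 * z + 5)) := by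
    rw [← Equiv.sum_comp (Equiv.subLeft (1 : F))]
    refine Finset.sum_congr rfl fun z _ ↦ ?_
    rw [Equiv.subLeft_apply]
    congr 1
    ring
  have hodd : ∑ z : F, quadraticChar F (2 * z * (z ^ 2 + 1)) = 0 :=
    sum_eq_zero_of_odd _ fun z ↦ by
      rw [← quadraticChar_neg_of_card_mod_four h4]
      congr 1
      ring
  have hk : ∑ X : F, quadraticChar F (2 * (1 + X) * (X ^ 2 + 2 * X + 2)) = 0 := by
    rw [← hodd, ← Equiv.sum_comp (Equiv.subRight (1 : F))]
    refine Finset.sum_congr rfl fun z _ ↦ ?_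
    rw [Equiv.subRight_apply]
    congr 1
    ring
  have hk' : ∑ X : F, quadraticChar F (2 * (1 - X) * (X ^ 2 - 2 * X + 2)) = 0 := by
    rw [← hodd, ← Equiv.sum_comp (Equiv.subLeft (1 : F))]
    refine Finset.sum_congr rfl fun z _ ↦ ?_
    rw [Equiv.subLeft_apply]
    congr 1
    ring
  have hiso : ∑ x : F, quadraticChar F (x * (x ^ 2 + 4 * x - 1)) =
      ∑ z : F, quadraticChar F (2 * z * (z ^ 2 - 4 * z + 5)) := by
    have h := sum_quadraticChar_isogeny hF 4 (b := (-1 : F)) (by simp)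
    simp only [← sub_eq_add_neg] at h
    rw [h, ← Equiv.sum_comp (Equiv.mulLeft₀ (2 : F) h2)]
    refine Finset.sum_congr rfl fun z _ ↦ ?_
    rw [Equiv.mulLeft₀_apply, show 2 * z * ((2 * z) ^ 2 - 2 * 4 * (2 * z) + (4 ^ 2 - 4 * -1)) =
      2 ^ 2 * (2 * z * (z ^ 2 - 4 * z + 5)) by ring, map_mul, quadraticChar_sq_one' h2, one_mul]
  rw [eight_mul_card_squareTriples_eq_sum h4]
  simp only [hpt, Finset.sum_add_distrib, hone, hh, hh', hk, hk', hiso,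
    sum_quadraticChar_quartic h4, sum_quadraticChar_sextic h4]
  simp
  ring

end SquareTriples

section SignClasses

variable {F : Type*} [Field F] [Fintype F] [DecidableEq F]

/-- Solutions of `y₁ - y₂ + y₃ = 1` and `χ(y₁) / y₁ - χ(y₂) / y₂ + χ(y₃) / y₃ = 1` whose
coordinates have prescribed quadratic characters. -/
def signClass (F : Type*) [Field F] [Fintype F] [DecidableEq F] (e : ℤ × ℤ × ℤ) :
    Finset (F × F × F) :=
  {y | (quadraticChar F y.1 = e.1 ∧ quadraticChar F y.2.1 = e.2.1 ∧ quadraticChar F y.2.2 = e.2.2) ∧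
    y.1 - y.2.1 + y.2.2 - 1 = 0 ∧ (e.1 : F) / y.1 - e.2.1 / y.2.1 + e.2.2 / y.2.2 - 1 = 0}

theorem ne_zero_of_quadraticChar_eq_neg_one {a : F} (h : quadraticChar F a = -1) : a ≠ 0 := by
  rintro rfl
  simp at h

theorem card_quadraticChar_eq_neg_one (h4 : Fintype.card F % 4 = 3) :
    #{k : F | quadraticChar F k = -1} = #{k : F | quadraticChar F k = 1} := by
  refine Finset.card_equiv (Equiv.neg F) fun k ↦ ?_
  simp only [mem_filter, mem_univ, true_and, Equiv.neg_apply,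
    quadraticChar_neg_of_card_mod_four h4]
  omega

theorem two_mul_card_quadraticChar_eq_one (h4 : Fintype.card F % 4 = 3) :
    2 * #{k : F | quadraticChar F k = 1} + 1 = Fintype.card F := by
  have h := Finset.card_filter_add_card_filter_not (s := univ.erase (0 : F))
    (fun k ↦ quadraticChar F k = 1)
  have h1 : {k ∈ univ.erase (0 : F) | quadraticChar F k = 1} =
      ({k : F | quadraticChar F k = 1} : Finset F) := by
    ext k
    simpa using ne_zero_of_quadraticChar_eq_one
  have h2 : {k ∈ univ.erase (0 : F) | ¬ quadraticChar F k = 1} =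
      ({k : F | quadraticChar F k = -1} : Finset F) := by
    ext k
    simp only [mem_filter, mem_erase, mem_univ, and_true, true_and]
    constructor
    · rintro ⟨hk, hk'⟩
      exact (quadraticChar_eq_neg_one_iff_not_one hk).2 hk'
    · intro hk
      exact ⟨ne_zero_of_quadraticChar_eq_neg_one hk, by rw [hk]; norm_num⟩
  rw [h1, h2, card_quadraticChar_eq_neg_one h4, card_erase_of_mem (mem_univ _), card_univ] at h
  have : 0 < Fintype.card F := Fintype.card_pos
  omega

theorem card_signClass_pos_pos_pos (h4 : Fintype.card F % 4 = 3) :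
    #(signClass F (1, 1, 1)) + 2 = Fintype.card F := by
  set Q : Finset F := {k : F | quadraticChar F k = 1} with hQ
  have hunion : signClass F (1, 1, 1) =
      Q.image (fun k ↦ (1, k, k)) ∪ (Q.erase 1).image (fun k ↦ (k, k, 1)) := by
    ext ⟨a, b, c⟩
    simp only [signClass, hQ, mem_filter, mem_univ, true_and, mem_union, mem_image, mem_erase,
      Prod.mk.injEq, Int.cast_one]
    constructor
    · rintro ⟨⟨ha, hb, hc⟩, h1, h2⟩
      have ha0 := ne_zero_of_quadraticChar_eq_one ha
      have hb0 := ne_zero_of_quadraticChar_eq_one hb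
      have hc0 := ne_zero_of_quadraticChar_eq_one hc
      have hs : b + 1 ≠ 0 := by
        intro h
        rw [eq_neg_of_add_eq_zero_left h, quadraticChar_neg_of_card_mod_four h4, map_one] at hb
        norm_num at hb
      field_simp at h2
      have hprod : (b + 1) * ((a - 1) * (c - 1)) = 0 := by
        linear_combination -h2 - h1
      by_cases ha1 : a = 1
      · exact Or.inl ⟨b, hb, ha1.symm, rfl, by linear_combination ha1 - h1⟩
      · have hc1 : c = 1 := by
          have := sub_ne_zero.2 ha1
          simpa [hs, this, sub_eq_zero] using hprod
        have hab : a = b := by linear_combination h1 - hc1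
        exact Or.inr ⟨a, ⟨ha1, ha⟩, rfl, hab, hc1.symm⟩
    · rintro (⟨k, hk, rfl, rfl, rfl⟩ | ⟨k, ⟨-, hk⟩, rfl, rfl, rfl⟩) <;> simp [hk]
  have hdisj : Disjoint (Q.image fun k ↦ ((1 : F), k, k))
      ((Q.erase 1).image fun k ↦ (k, k, (1 : F))) := by
    simp only [disjoint_left, mem_image, mem_erase, not_exists, not_and]
    rintro y ⟨k, -, rfl⟩ l ⟨hl, -⟩ h
    exact hl (congrArg Prod.fst h)
  have h1Q : (1 : F) ∈ Q := by simp [hQ]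
  have hpos := card_pos.2 ⟨_, h1Q⟩
  have := two_mul_card_quadraticChar_eq_one h4
  rw [hunion, card_union_of_disjoint hdisj,
    card_image_of_injective _ (fun _ _ h ↦ congrArg (·.2.1) h),
    card_image_of_injective _ (fun _ _ h ↦ congrArg (·.1) h), card_erase_of_mem h1Q]
  rw [← hQ] at this
  omega

theorem card_signClass_neg_pos_neg (h4 : Fintype.card F % 4 = 3) :
    #(signClass F (-1, 1, -1)) = 0 := by
  rw [card_eq_zero, eq_empty_iff_forall_notMem]
  rintro ⟨a, b, c⟩
  simp only [signClass, mem_filter, mem_univ, true_and, Int.cast_one, Int.cast_neg]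
  rintro ⟨⟨ha, hb, hc⟩, h1, h2⟩
  have ha0 := ne_zero_of_quadraticChar_eq_neg_one ha
  have hb0 := ne_zero_of_quadraticChar_eq_one hb
  have hc0 := ne_zero_of_quadraticChar_eq_neg_one hc
  field_simp at h2
  have hprod : (b + 1) * (b + a * c) = 0 := by
    linear_combination -h2 - b * h1
  rcases mul_eq_zero.1 hprod with h | h <;>
  · rw [eq_neg_of_add_eq_zero_left h, quadraticChar_neg_of_card_mod_four h4] at hb
    simp only [map_mul, map_one, ha, hc] at hb
    norm_num at hb

theorem card_signClass_neg_neg_pos (h4 : Fintype.card F % 4 = 3) :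
    #(signClass F (-1, -1, 1)) = #{k : F | quadraticChar F k = 1} := by
  rw [← card_quadraticChar_eq_neg_one h4]
  refine Finset.card_bij' (fun y _ ↦ y.1) (fun k _ ↦ (k, k, 1)) ?_ ?_ ?_ ?_
  · rintro ⟨a, b, c⟩ h
    simp only [signClass, mem_filter, mem_univ, true_and] at h ⊢
    exact h.1.1
  · intro k hk
    simp only [signClass, mem_filter, mem_univ, true_and] at hk ⊢
    simp [hk]
  · rintro ⟨a, b, c⟩ h
    simp only [signClass, mem_filter, mem_univ, true_and, Int.cast_one, Int.cast_neg] at h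
    obtain ⟨⟨ha, hb, hc⟩, h1, h2⟩ := h
    have ha0 := ne_zero_of_quadraticChar_eq_neg_one ha
    have hb0 := ne_zero_of_quadraticChar_eq_neg_one hb
    have hc0 := ne_zero_of_quadraticChar_eq_one hc
    field_simp at h2
    have hprod : (c - 1) * (c + a * b) = 0 := by
      linear_combination c * h1 - h2
    rcases mul_eq_zero.1 hprod with h | h
    · have hc1 : c = 1 := sub_eq_zero.1 h
      have hab : a = b := by linear_combination h1 - hc1
      simp [hc1, hab]
    · rw [eq_neg_of_add_eq_zero_left h, quadraticChar_neg_of_card_mod_four h4, map_mul, ha, hb] at hc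
      norm_num at hc
  · simp

/-- Interchanging the first and third coordinates. -/
theorem card_signClass_swap (e₁ e₂ e₃ : ℤ) :
    #(signClass F (e₁, e₂, e₃)) = #(signClass F (e₃, e₂, e₁)) := by
  refine Finset.card_bij' (fun y _ ↦ (y.2.2, y.2.1, y.1)) (fun y _ ↦ (y.2.2, y.2.1, y.1)) ?_ ?_
    (fun _ _ ↦ rfl) (fun _ _ ↦ rfl) <;>
  · rintro ⟨a, b, c⟩ h
    simp only [signClass, mem_filter, mem_univ, true_and] at h ⊢
    obtain ⟨⟨ha, hb, hc⟩, h1, h2⟩ := h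
    exact ⟨⟨hc, hb, ha⟩, by linear_combination h1, by linear_combination h2⟩

theorem card_signClass_neg_neg_neg (h4 : Fintype.card F % 4 = 3) :
    #(signClass F (-1, -1, -1)) = #(squareTriples F) := by
  refine Finset.card_bij' (fun y _ ↦ (-y.1, -y.2.2, -y.2.1)) (fun y _ ↦ (-y.1, -y.2.2, -y.2.1))
    ?_ ?_ (by simp) (by simp)
  · rintro ⟨a, b, c⟩ h
    simp only [signClass, squareTriples, mem_filter, mem_univ, true_and, Int.cast_neg, Int.cast_one,
      quadraticChar_neg_of_card_mod_four h4] at h ⊢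
    obtain ⟨⟨ha, hb, hc⟩, h1, h2⟩ := h
    have ha0 := ne_zero_of_quadraticChar_eq_neg_one ha
    have hb0 := ne_zero_of_quadraticChar_eq_neg_one hb
    have hc0 := ne_zero_of_quadraticChar_eq_neg_one hc
    field_simp at h2
    refine ⟨by simp [ha], by simp [hc], by simp [hb], by linear_combination -h1, ?_⟩
    linear_combination -h2
  · rintro ⟨a, b, c⟩ h
    simp only [signClass, squareTriples, mem_filter, mem_univ, true_and, Int.cast_neg, Int.cast_one,
      quadraticChar_neg_of_card_mod_four h4] at h ⊢
    obtain ⟨ha, hb, hc, h1, h2⟩ := h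
    have ha0 := ne_zero_of_quadraticChar_eq_one ha
    have hb0 := ne_zero_of_quadraticChar_eq_one hb
    have hc0 := ne_zero_of_quadraticChar_eq_one hc
    refine ⟨by simp [ha, hb, hc], by linear_combination -h1, ?_⟩
    field_simp
    linear_combination h2

theorem card_signClass_pos_neg_pos (h4 : Fintype.card F % 4 = 3) :
    #(signClass F (1, -1, 1)) = #(squareTriples F) := by
  refine Finset.card_bij' (fun y _ ↦ (-y.1 / y.2.1, -y.2.2 / y.2.1, -1 / y.2.1))
    (fun y _ ↦ (y.1 / y.2.2, -1 / y.2.2, y.2.1 / y.2.2)) ?_ ?_ ?_ ?_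
  · rintro ⟨a, b, c⟩ h
    simp only [signClass, squareTriples, mem_filter, mem_univ, true_and, Int.cast_neg, Int.cast_one,
      quadraticChar_neg_of_card_mod_four h4, quadraticChar_div] at h ⊢
    obtain ⟨⟨ha, hb, hc⟩, h1, h2⟩ := h
    have ha0 := ne_zero_of_quadraticChar_eq_one ha
    have hb0 := ne_zero_of_quadraticChar_eq_neg_one hb
    have hc0 := ne_zero_of_quadraticChar_eq_one hc
    field_simp at h2
    refine ⟨by simp [ha, hb], by simp [hb, hc], by simp [hb], ?_, ?_⟩
    · field_simp
      linear_combination -h1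
    · field_simp
      linear_combination h2
  · rintro ⟨a, b, c⟩ h
    simp only [signClass, squareTriples, mem_filter, mem_univ, true_and, Int.cast_neg, Int.cast_one,
      quadraticChar_neg_of_card_mod_four h4, quadraticChar_div] at h ⊢
    obtain ⟨ha, hb, hc, h1, h2⟩ := h
    have ha0 := ne_zero_of_quadraticChar_eq_one ha
    have hb0 := ne_zero_of_quadraticChar_eq_one hb
    have hc0 := ne_zero_of_quadraticChar_eq_one hc
    refine ⟨by simp [ha, hb, hc], ?_, ?_⟩
    · field_simp
      linear_combination h1
    · field_simp
      linear_combination h2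
  · rintro ⟨a, b, c⟩ h
    simp only [signClass, mem_filter, mem_univ, true_and] at h
    have hb0 := ne_zero_of_quadraticChar_eq_neg_one h.1.2.1
    ext <;> simp <;> field_simp
  · rintro ⟨a, b, c⟩ h
    simp only [squareTriples, mem_filter, mem_univ, true_and] at h
    have hc0 := ne_zero_of_quadraticChar_eq_one h.2.2.1
    ext <;> simp <;> field_simp

theorem card_signClass_pos_pos_neg (h4 : Fintype.card F % 4 = 3) :
    #(signClass F (1, 1, -1)) = #(squareTriples F) := by
  refine Finset.card_bij' (fun y _ ↦ (-y.2.1 / y.2.2, -1 / y.2.2, -y.1 / y.2.2))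
    (fun y _ ↦ (y.2.2 / y.2.1, y.1 / y.2.1, -1 / y.2.1)) ?_ ?_ ?_ ?_
  · rintro ⟨a, b, c⟩ h
    simp only [signClass, squareTriples, mem_filter, mem_univ, true_and, Int.cast_neg, Int.cast_one,
      quadraticChar_neg_of_card_mod_four h4, quadraticChar_div] at h ⊢
    obtain ⟨⟨ha, hb, hc⟩, h1, h2⟩ := h
    have ha0 := ne_zero_of_quadraticChar_eq_one ha
    have hb0 := ne_zero_of_quadraticChar_eq_one hb
    have hc0 := ne_zero_of_quadraticChar_eq_neg_one hc
    field_simp at h2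
    refine ⟨by simp [hb, hc], by simp [hc], by simp [ha, hc], ?_, ?_⟩
    · field_simp
      linear_combination h1
    · field_simp
      linear_combination -h2
  · rintro ⟨a, b, c⟩ h
    simp only [signClass, squareTriples, mem_filter, mem_univ, true_and, Int.cast_neg, Int.cast_one,
      quadraticChar_neg_of_card_mod_four h4, quadraticChar_div] at h ⊢
    obtain ⟨ha, hb, hc, h1, h2⟩ := h
    have ha0 := ne_zero_of_quadraticChar_eq_one ha
    have hb0 := ne_zero_of_quadraticChar_eq_one hb
    have hc0 := ne_zero_of_quadraticChar_eq_one hc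
    refine ⟨by simp [ha, hb, hc], ?_, ?_⟩
    · field_simp
      linear_combination -h1
    · field_simp
      linear_combination -h2
  · rintro ⟨a, b, c⟩ h
    simp only [signClass, mem_filter, mem_univ, true_and] at h
    have hc0 := ne_zero_of_quadraticChar_eq_neg_one h.1.2.2
    ext <;> simp <;> field_simp
  · rintro ⟨a, b, c⟩ h
    simp only [squareTriples, mem_filter, mem_univ, true_and] at h
    have hb0 := ne_zero_of_quadraticChar_eq_one h.2.1
    ext <;> simp <;> field_simp

theorem pow_eq_quadraticChar_div (h4 : Fintype.card F % 4 = 3) {y : F} (hy : y ≠ 0) :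
    y ^ ((Fintype.card F - 3) / 2) = (quadraticChar F y : F) / y := by
  rw [quadraticChar_eq_pow_of_char_ne_two' (ringChar_ne_two_of_card_mod_four h4), eq_div_iff hy,
    ← pow_succ]
  congr 1
  omega

end SignClasses

theorem stmt_7 (F : Type*) [Field F] [Fintype F] [DecidableEq F]
    (hq3 : Fintype.card F % 4 = 3) (hq : 3 < Fintype.card F)
    (d : ℕ) (hd : d = (Fintype.card F - 3) / 2)
    (lam : ℤ)
    (hlam : lam = (∑ x : F, quadraticChar F (x * (x ^ 2 + 4 * x - 1))) +
        ∑ x : F, quadraticChar F (x * (x ^ 2 - 2 * x + 5))) :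
    2 * ({y : F × F × F |
        y.1 ≠ 0 ∧ y.2.1 ≠ 0 ∧ y.2.2 ≠ 0 ∧
        y.1 - y.2.1 + y.2.2 - 1 = 0 ∧
        y.1 ^ d - y.2.1 ^ d + y.2.2 ^ d - 1 = 0}.ncard : ℤ) =
      5 * (Fintype.card F : ℤ) + lam - 13 := by
  set S : Finset (F × F × F) := {y : F × F × F | y.1 ≠ 0 ∧ y.2.1 ≠ 0 ∧ y.2.2 ≠ 0 ∧
    y.1 - y.2.1 + y.2.2 - 1 = 0 ∧ y.1 ^ d - y.2.1 ^ d + y.2.2 ^ d - 1 = 0} with hS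
  have hncard : {y : F × F × F | y.1 ≠ 0 ∧ y.2.1 ≠ 0 ∧ y.2.2 ≠ 0 ∧
      y.1 - y.2.1 + y.2.2 - 1 = 0 ∧ y.1 ^ d - y.2.1 ^ d + y.2.2 ^ d - 1 = 0}.ncard = #S := by
    rw [← Set.ncard_coe_finset, hS, coe_filter]
    simp
  have hmaps : ∀ y ∈ S, (quadraticChar F y.1, quadraticChar F y.2.1, quadraticChar F y.2.2) ∈
      ({1, -1} : Finset ℤ) ×ˢ ({1, -1} : Finset ℤ) ×ˢ ({1, -1} : Finset ℤ) := by
    intro y hy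
    simp only [hS, mem_filter, mem_univ, true_and] at hy
    simp only [mem_product, mem_insert, mem_singleton]
    exact ⟨quadraticChar_dichotomy hy.1, quadraticChar_dichotomy hy.2.1,
      quadraticChar_dichotomy hy.2.2.1⟩
  have hfiber : ∀ e ∈ ({1, -1} : Finset ℤ) ×ˢ ({1, -1} : Finset ℤ) ×ˢ ({1, -1} : Finset ℤ),
      {y ∈ S | (quadraticChar F y.1, quadraticChar F y.2.1, quadraticChar F y.2.2) = e} =
        signClass F e := by
    rintro ⟨e₁, e₂, e₃⟩ he
    simp only [mem_product, mem_insert, mem_singleton] at he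
    ext ⟨a, b, c⟩
    simp only [hS, signClass, mem_filter, mem_univ, true_and, Prod.mk.injEq]
    constructor
    · rintro ⟨⟨ha, hb, hc, h1, h2⟩, rfl, rfl, rfl⟩
      refine ⟨⟨rfl, rfl, rfl⟩, h1, ?_⟩
      rwa [hd, pow_eq_quadraticChar_div hq3 ha, pow_eq_quadraticChar_div hq3 hb,
        pow_eq_quadraticChar_div hq3 hc] at h2
    · rintro ⟨⟨rfl, rfl, rfl⟩, h1, h2⟩
      have hne (x : F) (hx : quadraticChar F x = 1 ∨ quadraticChar F x = -1) : x ≠ 0 :=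
        hx.elim ne_zero_of_quadraticChar_eq_one ne_zero_of_quadraticChar_eq_neg_one
      have ha := hne a he.1
      have hb := hne b he.2.1
      have hc := hne c he.2.2
      refine ⟨⟨ha, hb, hc, h1, ?_⟩, rfl, rfl, rfl⟩
      rwa [hd, pow_eq_quadraticChar_div hq3 ha, pow_eq_quadraticChar_div hq3 hb,
        pow_eq_quadraticChar_div hq3 hc]
  have hcard : #S = Fintype.card F - 2 + 2 * #{k : F | quadraticChar F k = 1} +
      4 * #(squareTriples F) := by
    rw [Finset.card_eq_sum_card_fiberwise hmaps,
      Finset.sum_congr rfl fun e he ↦ congrArg card (hfiber e he)]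
    have hne : (1 : ℤ) ∉ ({-1} : Finset ℤ) := by norm_num
    simp only [Finset.sum_product, Finset.sum_insert hne, Finset.sum_singleton]
    rw [card_signClass_swap (-1) 1 1, card_signClass_swap 1 (-1) (-1),
      card_signClass_neg_pos_neg hq3, card_signClass_neg_neg_pos hq3,
      card_signClass_neg_neg_neg hq3, card_signClass_pos_neg_pos hq3,
      card_signClass_pos_pos_neg hq3]
    have := card_signClass_pos_pos_pos hq3
    omega
  have hQ := two_mul_card_quadraticChar_eq_one hq3
  have hA := eight_mul_card_squareTriples hq3
  rw [← hlam] at hA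
  rw [hncard]
  omega
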